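/- Let α : A → C and β : B → C be homomorphisms of commutative rings, let D := α ×_C β be their pullback, and let p_A : D → A and p_B : D → B be the restrictions of the two projections. Regard Ker(β) as a D-module via p_B (i.e., (a,b)·x = bx for (a,b) ∈ D and x ∈ Ker(β)). Then D is a Noetherian ring if and only if Ker(β) is a Noetherian D-module and the subring p_A(D) of A is a Noetherian ring. In particular, if β is surjective, then D is Noetherian if and only if A is Noetherian and Ker(β) is a Noetherian D-module. -/

import Mathlib

/-- The pullback (fiber product) `α ×_C β = {(a, b) ∈ A × B | α a = β b}` of two
ring homomorphisms `α : A → C` and `β : B → C`, as a subring of `A × B`. -/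
def pullbackSubring {A B C : Type*} [CommRing A] [CommRing B] [CommRing C]
    (α : A →+* C) (β : B →+* C) : Subring (A × B) where
  carrier := {x : A × B | α x.1 = β x.2}
  one_mem' := by simp
  zero_mem' := by simp
  mul_mem' := by
    intro x y hx hy
    simp only [Set.mem_setOf_eq, Prod.fst_mul, Prod.snd_mul, map_mul] at *
    rw [hx, hy]
  add_mem' := by
    intro x y hx hy
    simp only [Set.mem_setOf_eq, Prod.fst_add, Prod.snd_add, map_add] at *
    rw [hx, hy]
  neg_mem' := by
    intro x hx
    simp only [Set.mem_setOf_eq, Prod.fst_neg, Prod.snd_neg, map_neg] at *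
    rw [hx]

/-- The inclusion `x ↦ (0, x)` of `Ker β` and the first projection sit in an exact sequence. -/
theorem pullback_aux {A B C : Type*} [CommRing A] [CommRing B] [CommRing C]
    (α : A →+* C) (β : B →+* C) :
    letI : Algebra ↥(pullbackSubring α β) B :=
      ((RingHom.snd A B).comp (pullbackSubring α β).subtype).toAlgebra
    (IsNoetherianRing ↥(pullbackSubring α β) ↔
        IsNoetherian ↥(pullbackSubring α β)
          ↥(Submodule.restrictScalars ↥(pullbackSubring α β) (RingHom.ker β)) ∧
        IsNoetherianRing ↥((RingHom.fst A B).comp (pullbackSubring α β).subtype).range) := by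
  letI : Algebra ↥(pullbackSubring α β) B :=
      ((RingHom.snd A B).comp (pullbackSubring α β).subtype).toAlgebra
  let p := (RingHom.fst A B).comp (pullbackSubring α β).subtype
  let i : ↥(Submodule.restrictScalars ↥(pullbackSubring α β) (RingHom.ker β)) →ₗ[↥(pullbackSubring α β)]
      ↥(pullbackSubring α β) :=
    { toFun := fun x => ⟨(0, x.1), by
        have hx : β x.1 = 0 := x.2
        change α 0 = β x.1
        rw [hx, map_zero]⟩
      map_add' := fun x y => by
        apply Subtype.ext
        apply Prod.ext
        · exact (add_zero (0 : A)).symm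
        · rfl
      map_smul' := fun r x => by
        apply Subtype.ext
        apply Prod.ext
        · exact (mul_zero (r.1.1 : A)).symm
        · rfl }
  have hi : Function.Injective i := fun x y h => by
    apply Subtype.ext
    exact congrArg (fun z : ↥(pullbackSubring α β) => z.1.2) h
  constructor
  · intro h
    exact ⟨isNoetherian_of_injective i hi,
      isNoetherianRing_of_surjective _ _ p.rangeRestrict p.rangeRestrict_surjective⟩
  · rintro ⟨h1, h2⟩
    have e : IsNoetherianRing (↥(pullbackSubring α β) ⧸ RingHom.ker p) :=
      isNoetherianRing_of_ringEquiv _ (RingHom.quotientKerEquivRange p).symm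
    have e2 : IsNoetherian ↥(pullbackSubring α β) (↥(pullbackSubring α β) ⧸ RingHom.ker p) :=
      (LinearMap.isNoetherian_iff_of_bijective (σ := Ideal.Quotient.mk (RingHom.ker p))
        { toFun := id, map_add' := fun _ _ => rfl, map_smul' := fun _ _ => rfl }
        Function.bijective_id).2 e
    refine isNoetherian_of_range_eq_ker i (Submodule.mkQ (RingHom.ker p)) ?_
    rw [Submodule.ker_mkQ]
    ext z
    constructor
    · rintro ⟨x, rfl⟩
      rfl
    · intro hz
      have hz1 : z.1.1 = 0 := hz
      have hz2 : α z.1.1 = β z.1.2 := z.2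
      rw [hz1, map_zero] at hz2
      refine ⟨⟨z.1.2, hz2.symm⟩, ?_⟩
      apply Subtype.ext
      exact Prod.ext hz1.symm rfl

theorem statement18 {A B C : Type*} [CommRing A] [CommRing B] [CommRing C]
    (α : A →+* C) (β : B →+* C) :
    letI : Algebra ↥(pullbackSubring α β) B :=
      ((RingHom.snd A B).comp (pullbackSubring α β).subtype).toAlgebra
    ((IsNoetherianRing ↥(pullbackSubring α β) ↔
        IsNoetherian ↥(pullbackSubring α β)
          ↥(Submodule.restrictScalars ↥(pullbackSubring α β) (RingHom.ker β)) ∧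
        IsNoetherianRing ↥((RingHom.fst A B).comp (pullbackSubring α β).subtype).range) ∧
      (Function.Surjective β →
        (IsNoetherianRing ↥(pullbackSubring α β) ↔
          IsNoetherianRing A ∧
            IsNoetherian ↥(pullbackSubring α β)
              ↥(Submodule.restrictScalars ↥(pullbackSubring α β) (RingHom.ker β))))) := by
  refine ⟨pullback_aux α β, fun hβ => ?_⟩
  refine (pullback_aux α β).trans (and_comm.trans (and_congr_left fun _ => ?_))
  have hs : Function.Surjective ((RingHom.fst A B).comp (pullbackSubring α β).subtype) := by
    intro a
    obtain ⟨b, hb⟩ := hβ (α a)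
    exact ⟨⟨(a, b), hb.symm⟩, rfl⟩
  have e : ((RingHom.fst A B).comp (pullbackSubring α β).subtype).range ≃+* A :=
    (RingEquiv.subringCongr (RingHom.range_eq_top.2 hs)).trans Subring.topEquiv
  exact ⟨fun _ => isNoetherianRing_of_ringEquiv _ e,
    fun _ => isNoetherianRing_of_ringEquiv _ e.symm⟩
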